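/- arXiv:0707.1486 — 4 statements merged into one kernel-verified Lean document; each statement's English description precedes it below -/
import Mathlib

section
/- Let μ be a probability measure on ℝ, let δ > 0, and let φ : ℝ → ℝ be a bounded nondecreasing function. Then ∫ (φ(t+δ) − φ(t)) dμ(t) ≤ s(μ, δ) · (sup_{t∈ℝ} φ(t) − inf_{t∈ℝ} φ(t)), where s(μ, δ) := sup_{λ∈ℝ} μ([λ−δ, λ+δ]). -/
open MeasureTheory

/-- The modulus of continuity `s(μ, ε) = sup_λ μ([λ-ε, λ+ε])` of a measure `μ` on `ℝ`. -/
noncomputable def modulusOfContinuity (μ : Measure ℝ) (ε : ℝ) : ℝ :=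
  ⨆ l : ℝ, (μ (Set.Icc (l - ε) (l + ε))).toReal

/-- The measure of a closed interval is at most the modulus of continuity. -/
theorem measure_Icc_le_modulusOfContinuity (μ : Measure ℝ) [IsFiniteMeasure μ] (ε l : ℝ) :
    μ (Set.Icc (l - ε) (l + ε)) ≤ ENNReal.ofReal (modulusOfContinuity μ ε) := by
  rw [← ENNReal.ofReal_toReal (measure_ne_top μ (Set.Icc (l - ε) (l + ε)))]
  refine ENNReal.ofReal_le_ofReal (le_ciSup (f := fun l : ℝ =>
    (μ (Set.Icc (l - ε) (l + ε))).toReal) ⟨(μ Set.univ).toReal, ?_⟩ l)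
  rintro _ ⟨m, rfl⟩
  exact ENNReal.toReal_mono (measure_ne_top μ _) (measure_mono (Set.subset_univ _))

theorem modulusOfContinuity_nonneg (μ : Measure ℝ) (ε : ℝ) : 0 ≤ modulusOfContinuity μ ε :=
  Real.iSup_nonneg fun _ => ENNReal.toReal_nonneg

/-- The set of points at which a shift by `δ` moves a monotone function across a given level
has measure at most the modulus of continuity. -/
theorem Monotone.measure_crossing_le {φ : ℝ → ℝ} (hφ : Monotone φ) (μ : Measure ℝ)
    [IsFiniteMeasure μ] (δ x : ℝ) :
    μ {t | x ∈ Set.Ioc (φ t) (φ (t + δ))} ≤ ENNReal.ofReal (modulusOfContinuity μ δ) := by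
  rcases Set.eq_empty_or_nonempty {t | x ∈ Set.Ioc (φ t) (φ (t + δ))} with h | ⟨c, hc⟩
  · rw [h, measure_empty]
    exact zero_le
  · refine (measure_mono fun t ht => ?_).trans (measure_Icc_le_modulusOfContinuity μ δ c)
    have h₁ := hφ.reflect_lt (hc.1.trans_le ht.2)
    have h₂ := hφ.reflect_lt (ht.1.trans_le hc.2)
    exact ⟨by linarith, h₂.le⟩

/-- Layer-cake bound for the averaged increment of a monotone function with values in
`Set.Icc a b`. -/
theorem Monotone.lintegral_increment_le {φ : ℝ → ℝ} (hφ : Monotone φ) (μ : Measure ℝ)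
    [IsFiniteMeasure μ] (δ : ℝ) {a b : ℝ} (hab : ∀ t, φ t ∈ Set.Icc a b) :
    ∫⁻ t, ENNReal.ofReal (φ (t + δ) - φ t) ∂μ ≤
      ENNReal.ofReal (modulusOfContinuity μ δ) * ENNReal.ofReal (b - a) := by
  have hm : Measurable φ := hφ.measurable
  have hS : MeasurableSet {p : ℝ × ℝ | p.2 ∈ Set.Ioc (φ p.1) (φ (p.1 + δ))} :=
    (measurableSet_lt (by fun_prop) measurable_snd).inter
      (measurableSet_le measurable_snd (by fun_prop))
  calc ∫⁻ t, ENNReal.ofReal (φ (t + δ) - φ t) ∂μ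
      = ∫⁻ t, volume (Prod.mk t ⁻¹' {p : ℝ × ℝ | p.2 ∈ Set.Ioc (φ p.1) (φ (p.1 + δ))}) ∂μ :=
        lintegral_congr fun t => Real.volume_Ioc.symm
    _ = ∫⁻ x, μ {t | x ∈ Set.Ioc (φ t) (φ (t + δ))} := by
        rw [← Measure.prod_apply hS, Measure.prod_apply_symm hS]
        rfl
    _ ≤ ∫⁻ x, (Set.Icc a b).indicator
          (fun _ => ENNReal.ofReal (modulusOfContinuity μ δ)) x := by
        refine lintegral_mono fun x => ?_
        by_cases hx : x ∈ Set.Icc a b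
        · rw [Set.indicator_of_mem hx]
          exact hφ.measure_crossing_le μ δ x
        · have h : {t | x ∈ Set.Ioc (φ t) (φ (t + δ))} = ∅ :=
            Set.eq_empty_of_forall_notMem fun t ht =>
              hx ⟨(hab t).1.trans ht.1.le, ht.2.trans (hab (t + δ)).2⟩
          rw [h, measure_empty]
          exact zero_le
    _ = ENNReal.ofReal (modulusOfContinuity μ δ) * ENNReal.ofReal (b - a) := by
        rw [lintegral_indicator_const measurableSet_Icc, Real.volume_Icc]

/-- Lemma 6 of Hundertmark–Killip–Nakamura–Stollmann–Veselić: for a bounded nondecreasing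
function `φ` and a probability measure `μ` on `ℝ`, the averaged increment
`∫ (φ(t+δ) - φ(t)) dμ(t)` is bounded by the modulus of continuity `s(μ, δ)` times the
total variation `sup φ - inf φ`. -/
theorem averaging_estimate (μ : Measure ℝ) [IsProbabilityMeasure μ] (δ : ℝ) (hδ : 0 < δ)
    (φ : ℝ → ℝ) (hmono : Monotone φ) (hbdd_above : BddAbove (Set.range φ))
    (hbdd_below : BddBelow (Set.range φ)) :
    ∫ t, (φ (t + δ) - φ t) ∂μ ≤
      modulusOfContinuity μ δ * ((⨆ t : ℝ, φ t) - ⨅ t : ℝ, φ t) := by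
  have hm : Measurable φ := hmono.measurable
  have hab : ∀ t, φ t ∈ Set.Icc (⨅ t, φ t) (⨆ t, φ t) := fun t =>
    ⟨ciInf_le hbdd_below t, le_ciSup hbdd_above t⟩
  rw [integral_eq_lintegral_of_nonneg_ae
    (Filter.Eventually.of_forall fun t => sub_nonneg.2 (hmono (by linarith)))
    (by fun_prop)]
  refine ENNReal.toReal_le_of_le_ofReal (mul_nonneg (modulusOfContinuity_nonneg μ δ)
    (sub_nonneg.2 ((hab 0).1.trans (hab 0).2))) ?_
  rw [ENNReal.ofReal_mul (modulusOfContinuity_nonneg μ δ)]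
  exact hmono.lintegral_increment_le μ δ hab
end

section
/- Let A and B be n×n Hermitian matrices over ℂ and let ρ : ℝ → ℝ be continuously differentiable with compactly supported derivative. Then Krein's trace identity holds: ∑_{i=1}^{n} ρ(λ_i(B)) − ∑_{i=1}^{n} ρ(λ_i(A)) = ∫_ℝ ρ′(λ) ξ(λ) dλ, where the spectral shift function ξ is the difference of eigenvalue counting functions, ξ(λ) := N_A(λ) − N_B(λ) with N_X(λ) := #{i : λ_i(X) ≤ λ} (eigenvalues counted with multiplicity). -/
open scoped ComplexOrder

/-- The eigenvalue counting function `N_X(λ) = #{i : λ_i(X) ≤ λ}` of a Hermitian matrix,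
eigenvalues counted with multiplicity. -/
noncomputable def eigCount {n : ℕ} {X : Matrix (Fin n) (Fin n) ℂ} (hX : X.IsHermitian)
    (l : ℝ) : ℕ :=
  (Finset.univ.filter (fun i => hX.eigenvalues i ≤ l)).card

open MeasureTheory Set

theorem mul_eigCount_eq_sum_indicator {n : ℕ} {X : Matrix (Fin n) (Fin n) ℂ}
    (hX : X.IsHermitian) (f : ℝ → ℝ) (l : ℝ) :
    f l * (eigCount hX l : ℝ) = ∑ i, (Ici (hX.eigenvalues i)).indicator f l := by
  simp [eigCount, indicator_apply, ← Finset.sum_filter, mul_comm]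

theorem integrable_mul_eigCount {n : ℕ} {X : Matrix (Fin n) (Fin n) ℂ}
    (hX : X.IsHermitian) {f : ℝ → ℝ} (hf : Integrable f) :
    Integrable fun l => f l * (eigCount hX l : ℝ) := by
  simp only [mul_eigCount_eq_sum_indicator]
  exact integrable_finsetSum _ fun i _ => hf.indicator measurableSet_Ici

theorem integral_mul_eigCount {n : ℕ} {X : Matrix (Fin n) (Fin n) ℂ}
    (hX : X.IsHermitian) {f : ℝ → ℝ} (hf : Integrable f) :
    ∫ l, f l * (eigCount hX l : ℝ) = ∑ i, ∫ l in Ioi (hX.eigenvalues i), f l := by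
  simp only [mul_eigCount_eq_sum_indicator]
  rw [integral_finsetSum _ fun i _ => hf.indicator measurableSet_Ici]
  simp only [integral_indicator measurableSet_Ici, integral_Ici_eq_integral_Ioi]

/-- Krein's trace identity for Hermitian matrices: for `ρ` continuously differentiable with
compactly supported derivative, `Tr ρ(B) - Tr ρ(A) = ∫ ρ'(λ) ξ(λ) dλ` where the spectral
shift function `ξ(λ) = N_A(λ) - N_B(λ)` is the difference of eigenvalue counting
functions. -/
theorem krein_trace_identity {n : ℕ} (A B : Matrix (Fin n) (Fin n) ℂ)
    (hA : A.IsHermitian) (hB : B.IsHermitian)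
    (ρ : ℝ → ℝ) (hρ : ContDiff ℝ 1 ρ) (hsupp : HasCompactSupport (deriv ρ)) :
    ∑ i, ρ (hB.eigenvalues i) - ∑ i, ρ (hA.eigenvalues i) =
      ∫ l : ℝ, deriv ρ l * ((eigCount hA l : ℝ) - (eigCount hB l : ℝ)) := by
  have hint : Integrable (deriv ρ) :=
    (hρ.continuous_deriv le_rfl).integrable_of_hasCompactSupport hsupp
  have hFTC (a b : ℝ) :
      (∫ l in Ioi a, deriv ρ l) - ∫ l in Ioi b, deriv ρ l = ρ b - ρ a := by
    rw [intervalIntegral.integral_Ioi_sub_Ioi' hint.integrableOn hint.integrableOn]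
    exact intervalIntegral.integral_deriv_eq_sub
      (fun x _ => hρ.differentiable one_ne_zero x) hint.intervalIntegrable
  simp only [mul_sub]
  rw [integral_sub (integrable_mul_eigCount hA hint) (integrable_mul_eigCount hB hint),
    integral_mul_eigCount hA hint, integral_mul_eigCount hB hint,
    ← Finset.sum_sub_distrib, ← Finset.sum_sub_distrib]
  simp only [hFTC]
end

section
/- Let A and P be n×n Hermitian matrices over ℂ with rank(P) ≤ r. Then for every λ ∈ ℝ, the eigenvalue counting functions of A and A + P differ by at most r: |N_{A+P}(λ) − N_A(λ)| ≤ r, where N_X(λ) := #{i : λ_i(X) ≤ λ} counts eigenvalues of X with multiplicity. -/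
open scoped ComplexOrder

namespace Matrix.IsHermitian

/-- The quadratic form of `A - l` in the coordinates of an orthonormal eigenbasis of `A`. -/
lemma re_inner_toEuclideanLin_sub_eq_sum {ι : Type*} [Fintype ι] [DecidableEq ι]
    {A : Matrix ι ι ℂ} (hA : A.IsHermitian) (l : ℝ) (v : EuclideanSpace ℂ ι) :
    (inner ℂ v (Matrix.toEuclideanLin A v)).re - l * ‖v‖ ^ 2 =
      ∑ i, (hA.eigenvalues i - l) * ‖inner ℂ (hA.eigenvectorBasis i) v‖ ^ 2 := by
  have hsym := Matrix.isSymmetric_toEuclideanLin_iff.mpr hA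
  have happly (i : ι) : Matrix.toEuclideanLin A (hA.eigenvectorBasis i) =
      (hA.eigenvalues i : ℂ) • hA.eigenvectorBasis i := by
    ext j
    simpa [Matrix.toLpLin_apply] using congrFun (hA.mulVec_eigenvectorBasis i) j
  have hcoord (i : ι) : inner ℂ (hA.eigenvectorBasis i) (Matrix.toEuclideanLin A v) =
      (hA.eigenvalues i : ℂ) * inner ℂ (hA.eigenvectorBasis i) v := by
    rw [← hsym, happly, inner_smul_left, Complex.conj_ofReal]
  rw [← hA.eigenvectorBasis.sum_inner_mul_inner v, ← hA.eigenvectorBasis.sum_sq_norm_inner_right v,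
    Complex.re_sum, Finset.mul_sum, ← Finset.sum_sub_distrib]
  refine Finset.sum_congr rfl fun i _ => ?_
  rw [hcoord, mul_left_comm, ← inner_conj_symm v, ← Complex.normSq_eq_conj_mul_self,
    ← Complex.ofReal_mul, Complex.ofReal_re, Complex.normSq_eq_norm_sq, sub_mul]

/-- One-sided bound: passing from `A` to `B` lowers the number of eigenvalues in `(-∞, l]` by at
most the rank of `B - A`. -/
lemma card_eigenvalues_le_le_add_rank_sub {ι : Type*} [Fintype ι] [DecidableEq ι]
    {A B : Matrix ι ι ℂ} (hA : A.IsHermitian) (hB : B.IsHermitian) (l : ℝ) :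
    (Finset.univ.filter fun i => hA.eigenvalues i ≤ l).card ≤
      (Finset.univ.filter fun i => hB.eigenvalues i ≤ l).card + (B - A).rank := by
  let D := (B - A).mulVecLin.rangeRestrict ∘ₗ (WithLp.linearEquiv 2 ℂ (ι → ℂ)).toLinearMap
  let a (i : {i // ¬ hA.eigenvalues i ≤ l}) := (innerSL ℂ (hA.eigenvectorBasis i)).toLinearMap
  let b (j : {j // hB.eigenvalues j ≤ l}) := (innerSL ℂ (hB.eigenvectorBasis j)).toLinearMap
  let T := (LinearMap.pi a).prod ((LinearMap.pi b).prod D)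
  have hT : Function.Injective T := by
    rw [← LinearMap.ker_eq_bot, LinearMap.ker_eq_bot']
    intro v hv
    have hva (i) (hi : ¬ hA.eigenvalues i ≤ l) : inner ℂ (hA.eigenvectorBasis i) v = 0 :=
      congrFun (congrArg Prod.fst hv) ⟨i, hi⟩
    have hvb (j) (hj : hB.eigenvalues j ≤ l) : inner ℂ (hB.eigenvectorBasis j) v = 0 :=
      congrFun (congrArg (fun p => p.2.1) hv) ⟨j, hj⟩
    have hvD : (B - A) *ᵥ v.ofLp = 0 := congrArg (fun p => (p.2.2 : ι → ℂ)) hv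
    have hAB : Matrix.toEuclideanLin B v = Matrix.toEuclideanLin A v := by
      rw [Matrix.sub_mulVec, sub_eq_zero] at hvD
      exact congrArg (WithLp.toLp 2) hvD
    have hnonneg (j) (_ : j ∈ Finset.univ) :
        0 ≤ (hB.eigenvalues j - l) * ‖inner ℂ (hB.eigenvectorBasis j) v‖ ^ 2 := by
      by_cases hj : hB.eigenvalues j ≤ l
      · simp [hvb j hj]
      · exact mul_nonneg (by linarith) (sq_nonneg _)
    have hnonpos : ∑ i, (hA.eigenvalues i - l) * ‖inner ℂ (hA.eigenvectorBasis i) v‖ ^ 2 ≤ 0 := by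
      refine Finset.sum_nonpos fun i _ => ?_
      by_cases hi : hA.eigenvalues i ≤ l
      · exact mul_nonpos_of_nonpos_of_nonneg (by linarith) (sq_nonneg _)
      · simp [hva i hi]
    rw [← hA.re_inner_toEuclideanLin_sub_eq_sum, ← hAB,
      hB.re_inner_toEuclideanLin_sub_eq_sum] at hnonpos
    have hzero := (Finset.sum_eq_zero_iff_of_nonneg hnonneg).mp
      (hnonpos.antisymm (Finset.sum_nonneg hnonneg))
    refine InnerProductSpace.ext_inner_left_basis hB.eigenvectorBasis.toBasis fun j => ?_
    rw [hB.eigenvectorBasis.coe_toBasis, inner_zero_right]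
    by_cases hj : hB.eigenvalues j ≤ l
    · exact hvb j hj
    · simpa [sub_eq_zero, (not_le.mp hj).ne'] using hzero j (Finset.mem_univ j)
  have hdim := LinearMap.finrank_le_finrank_of_injective hT
  have hrank : Module.finrank ℂ (LinearMap.range (B - A).mulVecLin) = (B - A).rank := rfl
  rw [Module.finrank_prod, Module.finrank_prod, hrank, finrank_euclideanSpace,
    Module.finrank_fintype_fun_eq_card, Module.finrank_fintype_fun_eq_card,
    Fintype.card_subtype_compl, Fintype.card_subtype, Fintype.card_subtype] at hdim
  have := Finset.card_filter_le Finset.univ fun i => hA.eigenvalues i ≤ l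
  rw [Finset.card_univ] at this
  omega

end Matrix.IsHermitian

/-- A perturbation of rank at most `r` shifts the eigenvalue counting function of a
Hermitian matrix by at most `r`: `|N_{A+P}(λ) - N_A(λ)| ≤ r` for all `λ ∈ ℝ`. -/
theorem eigCount_diff_le_rank {n : ℕ} (A P : Matrix (Fin n) (Fin n) ℂ)
    (hA : A.IsHermitian) (hP : P.IsHermitian) (r : ℕ) (hrank : P.rank ≤ r) (l : ℝ) :
    |(eigCount (hA.add hP) l : ℤ) - (eigCount hA l : ℤ)| ≤ (r : ℤ) := by
  have h₁ := hA.card_eigenvalues_le_le_add_rank_sub (hA.add hP) l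
  have h₂ := (hA.add hP).card_eigenvalues_le_le_add_rank_sub hA l
  rw [add_sub_cancel_left] at h₁
  rw [← sub_sub, sub_self, zero_sub, ← neg_one_smul ℂ P, Matrix.rank_smul_of_mem_nonZeroDivisors P
    (mem_nonZeroDivisors_of_ne_zero (neg_ne_zero.mpr one_ne_zero))] at h₂
  rw [abs_sub_le_iff]
  unfold eigCount
  omega
end

section
/- Let A and B be n×n Hermitian matrices over ℂ, and let ρ : ℝ → ℝ be nondecreasing, continuously differentiable with compactly supported derivative, and satisfy lim_{x→−∞} ρ(x) = −1 and lim_{x→+∞} ρ(x) = 0. Then |∑_{i=1}^{n} ρ(λ_i(B)) − ∑_{i=1}^{n} ρ(λ_i(A))| ≤ sup_{λ∈ℝ} |N_A(λ) − N_B(λ)|, where N_X(λ) := #{i : λ_i(X) ≤ λ} counts eigenvalues of X with multiplicity. -/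
open scoped ComplexOrder

open MeasureTheory in
/-- Krein's trace identity for one matrix: the trace of a function vanishing at `+∞` is
minus the integral of the counting function against its derivative. -/
theorem sum_eq_neg_integral_eigCount_mul_deriv {n : ℕ} {X : Matrix (Fin n) (Fin n) ℂ}
    (hX : X.IsHermitian) {ρ : ℝ → ℝ} (hρ : Differentiable ℝ ρ)
    (hint : Integrable (deriv ρ)) (htop : Filter.Tendsto ρ Filter.atTop (nhds 0)) :
    Integrable (fun l ↦ (eigCount hX l : ℝ) * deriv ρ l) ∧
      ∑ i, ρ (hX.eigenvalues i) = -∫ l, (eigCount hX l : ℝ) * deriv ρ l := by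
  have hsum : (fun l ↦ (eigCount hX l : ℝ) * deriv ρ l) =
      fun l ↦ ∑ i, (Set.Ici (hX.eigenvalues i)).indicator (deriv ρ) l := by
    ext l
    simp [eigCount, Set.indicator_apply, Finset.sum_ite]
  have hind (i : Fin n) :
      Integrable ((Set.Ici (hX.eigenvalues i)).indicator (deriv ρ)) :=
    hint.indicator measurableSet_Ici
  rw [hsum]
  refine ⟨integrable_finsetSum _ fun i _ ↦ hind i, ?_⟩
  rw [integral_finsetSum _ fun i _ ↦ hind i, ← Finset.sum_neg_distrib]
  refine Finset.sum_congr rfl fun i _ ↦ ?_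
  rw [integral_indicator measurableSet_Ici, integral_Ici_eq_integral_Ioi,
    integral_Ioi_of_hasDerivAt_of_tendsto' (fun x _ ↦ (hρ x).hasDerivAt)
      hint.integrableOn htop]
  ring

theorem eigCount_le {n : ℕ} {X : Matrix (Fin n) (Fin n) ℂ} (hX : X.IsHermitian) (l : ℝ) :
    eigCount hX l ≤ n :=
  (Finset.card_filter_le _ _).trans (by simp)

theorem bddAbove_range_abs_eigCount_sub {n : ℕ} {A B : Matrix (Fin n) (Fin n) ℂ}
    (hA : A.IsHermitian) (hB : B.IsHermitian) :
    BddAbove (Set.range fun l : ℝ ↦ |(eigCount hA l : ℝ) - (eigCount hB l : ℝ)|) := by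
  refine ⟨n, ?_⟩
  rintro _ ⟨l, rfl⟩
  have hAn : (eigCount hA l : ℝ) ≤ n := mod_cast eigCount_le hA l
  have hBn : (eigCount hB l : ℝ) ≤ n := mod_cast eigCount_le hB l
  exact abs_sub_le_of_nonneg_of_le (Nat.cast_nonneg _) hAn (Nat.cast_nonneg _) hBn

/-- For a switch function `ρ` (nondecreasing, `C¹` with compactly supported derivative,
tending to `-1` at `-∞` and `0` at `+∞`), the trace difference `|Tr ρ(B) - Tr ρ(A)|` is
bounded by the sup norm of the spectral shift function `ξ(λ) = N_A(λ) - N_B(λ)`. -/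
theorem trace_diff_le_ssf_sup {n : ℕ} (A B : Matrix (Fin n) (Fin n) ℂ)
    (hA : A.IsHermitian) (hB : B.IsHermitian)
    (ρ : ℝ → ℝ) (hmono : Monotone ρ) (hρ : ContDiff ℝ 1 ρ)
    (hsupp : HasCompactSupport (deriv ρ))
    (hbot : Filter.Tendsto ρ Filter.atBot (nhds (-1)))
    (htop : Filter.Tendsto ρ Filter.atTop (nhds 0)) :
    |∑ i, ρ (hB.eigenvalues i) - ∑ i, ρ (hA.eigenvalues i)| ≤
      ⨆ l : ℝ, |(eigCount hA l : ℝ) - (eigCount hB l : ℝ)| := by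
  have hdiff : Differentiable ℝ ρ := hρ.differentiable one_ne_zero
  have hint : MeasureTheory.Integrable (deriv ρ) :=
    (hρ.continuous_deriv le_rfl).integrable_of_hasCompactSupport hsupp
  have htotal : ∫ l, deriv ρ l = 1 := by
    rw [MeasureTheory.integral_of_hasDerivAt_of_tendsto (fun x ↦ (hdiff x).hasDerivAt)
      hint hbot htop]
    norm_num
  obtain ⟨hiA, hsA⟩ := sum_eq_neg_integral_eigCount_mul_deriv hA hdiff hint htop
  obtain ⟨hiB, hsB⟩ := sum_eq_neg_integral_eigCount_mul_deriv hB hdiff hint htop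
  set S := ⨆ l : ℝ, |(eigCount hA l : ℝ) - (eigCount hB l : ℝ)|
  calc |∑ i, ρ (hB.eigenvalues i) - ∑ i, ρ (hA.eigenvalues i)|
      = ‖∫ l, ((eigCount hA l : ℝ) * deriv ρ l - (eigCount hB l : ℝ) * deriv ρ l)‖ := by
        rw [MeasureTheory.integral_sub hiA hiB, hsA, hsB, Real.norm_eq_abs]
        ring_nf
    _ ≤ ∫ l, S * deriv ρ l := by
        refine MeasureTheory.norm_integral_le_of_norm_le (hint.const_mul S)
          (Filter.Eventually.of_forall fun l ↦ ?_)
        rw [← sub_mul, norm_mul, Real.norm_eq_abs, Real.norm_of_nonneg hmono.deriv_nonneg]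
        exact mul_le_mul_of_nonneg_right
          (le_ciSup (bddAbove_range_abs_eigCount_sub hA hB) l) hmono.deriv_nonneg
    _ = S := by rw [MeasureTheory.integral_const_mul, htotal, mul_one]
end
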